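/- arXiv:2511.11875 — 7 statements merged into one kernel-verified Lean document; each statement's English description precedes it below -/
import Mathlib

section
/- (Theorem 1, single-neuron signal approximation) Let Δ > 0, α > 0, set K = α/Δ, and let ξ₀ ∈ [0, Δ). For an integrate-and-fire neuron with threshold Δ, initial state ξ₀ and nonnegative locally integrable input f, the cumulative spike output α·N(t) approximates the integral of the scaled input: for all t ≥ 0, | ∫₀ᵗ K·f(σ) dσ − α·N(t) | ≤ α. -/
open MeasureTheory

/-- Spike times of an integrate-and-fire neuron with firing threshold `Δ`, initial state `ξ₀`
and input `f`: `t 0 = 0` and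
`t (j+1) = inf { u > t j : ξ_j + ∫_{t j}^{u} f ≥ Δ }` (with `inf ∅ = ⊤`),
where `ξ_j = ξ₀` for `j = 0` and `ξ_j = 0` for `j ≥ 1`. -/
noncomputable def spikeTime (Δ ξ₀ : ℝ) (f : ℝ → ℝ) : ℕ → EReal
  | 0 => ((0 : ℝ) : EReal)
  | j + 1 =>
      sInf {s : EReal | ∃ u : ℝ, s = (u : EReal) ∧
        spikeTime Δ ξ₀ f j < (u : EReal) ∧
        Δ ≤ (if j = 0 then ξ₀ else 0) + ∫ σ in (spikeTime Δ ξ₀ f j).toReal..u, f σ}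

/-- `spikeCount Δ ξ₀ f t` is the number of spikes `N(t) = #{ j ≥ 1 : t_j ≤ t }` fired by the
integrate-and-fire neuron up to and including time `t`. -/
noncomputable def spikeCount (Δ ξ₀ : ℝ) (f : ℝ → ℝ) (t : ℝ) : ℕ :=
  Set.ncard {j : ℕ | 1 ≤ j ∧ spikeTime Δ ξ₀ f j ≤ (t : EReal)}

/-- The neuron state `ξ(t) = ξ_{N(t)} + ∫_{t_{N(t)}}^{t} f(σ) dσ`. -/
noncomputable def neuronState (Δ ξ₀ : ℝ) (f : ℝ → ℝ) (t : ℝ) : ℝ :=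
  (if spikeCount Δ ξ₀ f t = 0 then ξ₀ else 0) +
    ∫ σ in (spikeTime Δ ξ₀ f (spikeCount Δ ξ₀ f t)).toReal..t, f σ

theorem snua_F_props (f : ℝ → ℝ) (hf_nonneg : ∀ σ, 0 ≤ f σ)
    (hf_loc : ∀ T : ℝ, IntegrableOn f (Set.Icc 0 T)) :
    (∀ a b : ℝ, 0 ≤ a → 0 ≤ b → IntervalIntegrable f volume a b) ∧
    (∀ T : ℝ, 0 ≤ T → ContinuousOn (fun t => ∫ σ in (0 : ℝ)..t, f σ) (Set.Icc 0 T)) ∧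
    (∀ a b : ℝ, 0 ≤ a → a ≤ b → (∫ σ in (0 : ℝ)..a, f σ) ≤ ∫ σ in (0 : ℝ)..b, f σ) := by
  have hI : ∀ a b : ℝ, 0 ≤ a → 0 ≤ b → IntervalIntegrable f volume a b := by
    intro a b ha hb
    rw [intervalIntegrable_iff]
    apply (hf_loc (max a b)).mono_set
    intro x hx
    rw [Set.uIoc, Set.mem_Ioc] at hx
    exact ⟨(le_min ha hb).trans hx.1.le, hx.2⟩
  refine ⟨hI, ?_, ?_⟩
  · intro T hT
    have := intervalIntegral.continuousOn_primitive_interval (μ := volume) (f := f)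
      (a := 0) (b := T) (by rw [Set.uIcc_of_le hT]; exact hf_loc T)
    rwa [Set.uIcc_of_le hT] at this
  · intro a b ha hab
    have h := intervalIntegral.integral_interval_sub_left (hI 0 b le_rfl (ha.trans hab))
      (hI 0 a le_rfl ha)
    have h2 : 0 ≤ ∫ σ in a..b, f σ :=
      intervalIntegral.integral_nonneg hab (fun u _ => hf_nonneg u)
    linarith

/-- The cumulative input level at which the `j`-th spike happens. -/
noncomputable def snuaLevel (Δ ξ₀ : ℝ) (j : ℕ) : ℝ := if j = 0 then 0 else j * Δ - ξ₀

theorem snua_level_succ (Δ ξ₀ : ℝ) (j : ℕ) :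
    snuaLevel Δ ξ₀ (j + 1) = snuaLevel Δ ξ₀ j + Δ - (if j = 0 then ξ₀ else 0) := by
  unfold snuaLevel
  by_cases h : j = 0
  · subst h; simp
  · simp [h]; ring

theorem snua_spike (Δ ξ₀ : ℝ) (hΔ : 0 < Δ) (hξ₀ : ξ₀ ∈ Set.Ico 0 Δ)
    (f : ℝ → ℝ) (hf_nonneg : ∀ σ, 0 ≤ f σ)
    (hf_loc : ∀ T : ℝ, IntegrableOn f (Set.Icc 0 T)) (j : ℕ) :
    0 ≤ snuaLevel Δ ξ₀ j ∧
    ((spikeTime Δ ξ₀ f j = ⊤ ∧ ∀ t : ℝ, 0 ≤ t → (∫ σ in (0 : ℝ)..t, f σ) < snuaLevel Δ ξ₀ j) ∨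
    ∃ τ : ℝ, spikeTime Δ ξ₀ f j = (τ : EReal) ∧ 0 ≤ τ ∧
      (∫ σ in (0 : ℝ)..τ, f σ) = snuaLevel Δ ξ₀ j ∧
      ∀ t : ℝ, 0 ≤ t → snuaLevel Δ ξ₀ j ≤ (∫ σ in (0 : ℝ)..t, f σ) → τ ≤ t) := by
  obtain ⟨hI, hC, hM⟩ := snua_F_props f hf_nonneg hf_loc
  induction j with
  | zero =>
    refine ⟨by simp [snuaLevel], Or.inr ⟨0, ?_, le_rfl, ?_, ?_⟩⟩
    · rw [spikeTime]
    · simp [snuaLevel]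
    · intro t ht _; exact ht
  | succ j ih =>
    obtain ⟨h0, ih⟩ := ih
    have hlt : snuaLevel Δ ξ₀ j < snuaLevel Δ ξ₀ (j + 1) := by
      rw [snua_level_succ]
      obtain ⟨h1, h2⟩ := hξ₀
      split_ifs <;> linarith
    refine ⟨h0.trans hlt.le, ?_⟩
    rcases ih with ⟨htop, hF⟩ | ⟨τ, hτ, hτ0, hFτ, hmin⟩
    · left
      refine ⟨?_, fun t ht => (hF t ht).trans hlt⟩
      rw [spikeTime, htop]
      simp
    · have hset : ∀ u : ℝ, τ < u →
          ((Δ ≤ (if j = 0 then ξ₀ else 0) + ∫ σ in τ..u, f σ) ↔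
            snuaLevel Δ ξ₀ (j + 1) ≤ ∫ σ in (0 : ℝ)..u, f σ) := by
        intro u hu
        have h := intervalIntegral.integral_interval_sub_left (hI 0 u le_rfl (hτ0.trans hu.le))
          (hI 0 τ le_rfl hτ0)
        rw [snua_level_succ, ← h, ← hFτ]
        constructor <;> intro h <;> linarith
      have hgt : ∀ u : ℝ, 0 ≤ u → snuaLevel Δ ξ₀ (j + 1) ≤ (∫ σ in (0 : ℝ)..u, f σ) → τ < u := by
        intro u hu0 hu
        by_contra hcon
        have := hM u τ hu0 (not_lt.mp hcon)
        linarith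
      by_cases hex : ∃ u : ℝ, 0 ≤ u ∧ snuaLevel Δ ξ₀ (j + 1) ≤ ∫ σ in (0 : ℝ)..u, f σ
      · right
        obtain ⟨u, hu0, hu⟩ := hex
        have hcl : IsClosed (Set.Icc 0 u ∩
            (fun t => ∫ σ in (0 : ℝ)..t, f σ) ⁻¹' (Set.Ici (snuaLevel Δ ξ₀ (j + 1)))) :=
          (hC u hu0).preimage_isClosed_of_isClosed isClosed_Icc isClosed_Ici
        have hcp := isCompact_Icc.of_isClosed_subset hcl Set.inter_subset_left
        obtain ⟨m, ⟨⟨hm0, hmu⟩, hmL⟩, hml⟩ := hcp.exists_isLeast ⟨u, ⟨hu0, le_rfl⟩, hu⟩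
        simp only [Set.mem_preimage, Set.mem_Ici] at hmL
        have hmin' : ∀ t : ℝ, 0 ≤ t →
            snuaLevel Δ ξ₀ (j + 1) ≤ (∫ σ in (0 : ℝ)..t, f σ) → m ≤ t := by
          intro t ht htL
          rcases le_total t u with h | h
          · exact hml ⟨⟨ht, h⟩, htL⟩
          · exact hmu.trans h
        refine ⟨m, ?_, hm0, ?_, hmin'⟩
        · rw [spikeTime, hτ]
          apply IsLeast.csInf_eq
          refine ⟨⟨m, rfl, EReal.coe_lt_coe_iff.mpr (hgt m hm0 hmL), ?_⟩, ?_⟩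
          · rw [EReal.toReal_coe]
            exact (hset m (hgt m hm0 hmL)).mpr hmL
          · rintro s ⟨v, rfl, hv1, hv2⟩
            rw [EReal.toReal_coe] at hv2
            have hv1 := EReal.coe_lt_coe_iff.mp hv1
            exact EReal.coe_le_coe_iff.mpr
              (hmin' v (hτ0.trans hv1.le) ((hset v hv1).mp hv2))
        · have hivt := intermediate_value_Icc hm0 (hC m hm0)
          obtain ⟨v, hv, hvL⟩ := hivt (show snuaLevel Δ ξ₀ (j + 1) ∈ _ from
            ⟨by simpa using h0.trans hlt.le, hmL⟩)
          have hvL : (∫ σ in (0 : ℝ)..v, f σ) = snuaLevel Δ ξ₀ (j + 1) := hvL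
          have := hmin' v hv.1 hvL.ge
          have hvm : v = m := le_antisymm hv.2 this
          rw [← hvm]; exact hvL
      · left
        push Not at hex
        refine ⟨?_, hex⟩
        rw [spikeTime, hτ]
        rw [sInf_eq_top]
        rintro s ⟨v, rfl, hv1, hv2⟩
        rw [EReal.toReal_coe] at hv2
        have hv1 := EReal.coe_lt_coe_iff.mp hv1
        exact absurd ((hset v hv1).mp hv2) (not_le.mpr (hex v (hτ0.trans hv1.le)))

/-- Theorem 1, single-neuron signal approximation: with `K = α/Δ`, the cumulative
spike output `α·N(t)` approximates `∫₀ᵗ K·f(σ) dσ` to within `α`, for all `t ≥ 0`. -/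
theorem single_neuron_universal_approximation
    (Δ α K ξ₀ : ℝ) (hΔ : 0 < Δ) (hα : 0 < α) (hK : K = α / Δ)
    (hξ₀ : ξ₀ ∈ Set.Ico 0 Δ)
    (f : ℝ → ℝ) (hf_meas : Measurable f) (hf_nonneg : ∀ σ, 0 ≤ f σ)
    (hf_loc : ∀ T : ℝ, IntegrableOn f (Set.Icc 0 T)) :
    ∀ t : ℝ, 0 ≤ t →
      |(∫ σ in (0 : ℝ)..t, K * f σ) - α * (spikeCount Δ ξ₀ f t : ℝ)| ≤ α := by
  intro t ht
  obtain ⟨hI, hC, hM⟩ := snua_F_props f hf_nonneg hf_loc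
  have hF0 : 0 ≤ ∫ σ in (0 : ℝ)..t, f σ :=
    intervalIntegral.integral_nonneg ht (fun u _ => hf_nonneg u)
  obtain ⟨h1, h2⟩ := hξ₀
  have hiff : ∀ j : ℕ, spikeTime Δ ξ₀ f j ≤ (t : EReal) ↔
      snuaLevel Δ ξ₀ j ≤ ∫ σ in (0 : ℝ)..t, f σ := by
    intro j
    rcases (snua_spike Δ ξ₀ hΔ ⟨h1, h2⟩ f hf_nonneg hf_loc j).2 with
      ⟨htop, hF⟩ | ⟨τ, hτ, hτ0, hFτ, hmin⟩
    · rw [htop]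
      constructor
      · intro h
        exact absurd (top_le_iff.mp h) (EReal.coe_ne_top t)
      · intro h
        exact absurd h (not_le.mpr (hF t ht))
    · rw [hτ, EReal.coe_le_coe_iff]
      exact ⟨fun h => hFτ ▸ hM τ t hτ0 h, hmin t ht⟩
  set F := ∫ σ in (0 : ℝ)..t, f σ with hFdef
  have hq : 0 ≤ (F + ξ₀) / Δ := by positivity
  have hcount : spikeCount Δ ξ₀ f t = ⌊(F + ξ₀) / Δ⌋₊ := by
    unfold spikeCount
    have : {j : ℕ | 1 ≤ j ∧ spikeTime Δ ξ₀ f j ≤ (t : EReal)} =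
        ((Finset.Icc 1 ⌊(F + ξ₀) / Δ⌋₊ : Finset ℕ) : Set ℕ) := by
      ext j
      simp only [Set.mem_setOf_eq, Finset.coe_Icc, Set.mem_Icc]
      refine and_congr_right fun hj => ?_
      rw [hiff, Nat.le_floor_iff hq, le_div_iff₀ hΔ, snuaLevel, if_neg (by omega)]
      constructor <;> intro h <;> linarith
    rw [this, Set.ncard_coe_finset, Nat.card_Icc]
    simp
  rw [intervalIntegral.integral_const_mul, hcount, ← hFdef, hK]
  have hfl := Nat.floor_le hq
  have hfu := Nat.lt_floor_add_one ((F + ξ₀) / Δ)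
  set n : ℝ := (⌊(F + ξ₀) / Δ⌋₊ : ℝ)
  have hx1 : ξ₀ / Δ < 1 := (div_lt_one hΔ).mpr h2
  have hx0 : 0 ≤ ξ₀ / Δ := by positivity
  rw [add_div] at hfl hfu
  have e : α / Δ * F - α * n = α * (F / Δ - n) := by ring
  rw [e, abs_mul, abs_of_pos hα]
  have : |F / Δ - n| ≤ 1 := abs_le.mpr ⟨by linarith, by linarith⟩
  nlinarith
end

section
/- (Theorem 1, two-neuron network) Let K₁, K₂, α₁, α₂, Δ₁, Δ₂ > 0 with K₁ = α₁/Δ₁ and K₂ = α₂/Δ₂. Then for every measurable, locally essentially bounded signal y : [0,∞) → ℝ and all t ≥ 0, | ∫₀ᵗ ( max(0, K₁ y(s)) − max(0, −K₂ y(s)) ) ds − ( α₁ N₁(t) − α₂ N₂(t) ) | ≤ α₁ + α₂. -/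
open MeasureTheory

section helpers

variable {Δ ξ₀ : ℝ} {f : ℝ → ℝ}

theorem spike_char (hΔ : 0 < Δ) (hξ : ξ₀ ∈ Set.Ico 0 Δ) (hf : ∀ x, 0 ≤ f x)
    (hint : ∀ a b, 0 ≤ a → 0 ≤ b → IntervalIntegrable f volume a b) (j : ℕ) :
    (j ≠ 0 ∧ spikeTime Δ ξ₀ f j = ⊤ ∧ ∀ u : ℝ, 0 ≤ u → ξ₀ + ∫ σ in (0:ℝ)..u, f σ < j * Δ) ∨
    ∃ τ : ℝ, 0 ≤ τ ∧ spikeTime Δ ξ₀ f j = (τ : EReal) ∧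
      (ξ₀ + ∫ σ in (0:ℝ)..τ, f σ = if j = 0 then ξ₀ else j * Δ) ∧
      ∀ u : ℝ, 0 ≤ u → u < τ → ξ₀ + ∫ σ in (0:ℝ)..u, f σ < j * Δ := by
  have hmono : ∀ a b : ℝ, 0 ≤ a → a ≤ b →
      ξ₀ + ∫ σ in (0:ℝ)..a, f σ ≤ ξ₀ + ∫ σ in (0:ℝ)..b, f σ := by
    intro a b ha hab
    have h1 := intervalIntegral.integral_add_adjacent_intervals
      (hint 0 a le_rfl ha) (hint a b ha (ha.trans hab))
    have h2 : 0 ≤ ∫ σ in a..b, f σ := intervalIntegral.integral_nonneg hab (fun x _ => hf x)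
    linarith
  induction j with
  | zero =>
    right
    refine ⟨0, le_rfl, by simp [spikeTime], by simp, ?_⟩
    intro u hu hu'
    linarith
  | succ j ih =>
    rcases ih with ⟨hj, htop, hlt⟩ | ⟨τ, hτ, hst, hF, -⟩
    · left
      refine ⟨by omega, ?_, ?_⟩
      · rw [spikeTime, htop]
        simp
      · intro u hu
        have := hlt u hu
        push_cast
        nlinarith
    · have hFlt : ξ₀ + ∫ σ in (0:ℝ)..τ, f σ < ((j + 1 : ℕ) : ℝ) * Δ := by
        rw [hF]
        push_cast
        split_ifs with h
        · subst h; simpa using hξ.2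
        · nlinarith
      have hiff : ∀ u : ℝ, τ < u →
          (Δ ≤ (if j = 0 then ξ₀ else 0) + ∫ σ in τ..u, f σ ↔
            ((j + 1 : ℕ) : ℝ) * Δ ≤ ξ₀ + ∫ σ in (0:ℝ)..u, f σ) := by
        intro u hu
        have h1 := intervalIntegral.integral_add_adjacent_intervals
          (hint 0 τ le_rfl hτ) (hint τ u hτ (hτ.trans hu.le))
        rw [← h1]
        push_cast
        split_ifs at hF ⊢ with h
        · subst h
          constructor <;> intro h2 <;> push_cast at * <;> linarith
        · constructor <;> intro h2 <;> linarith
      have hset : {s : EReal | ∃ u : ℝ, s = (u : EReal) ∧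
          spikeTime Δ ξ₀ f j < (u : EReal) ∧
          Δ ≤ (if j = 0 then ξ₀ else 0) + ∫ σ in (spikeTime Δ ξ₀ f j).toReal..u, f σ} =
          {s : EReal | ∃ u : ℝ, s = (u : EReal) ∧ τ < u ∧
            ((j + 1 : ℕ) : ℝ) * Δ ≤ ξ₀ + ∫ σ in (0:ℝ)..u, f σ} := by
        ext s
        simp only [Set.mem_ofPred_eq, hst, EReal.coe_lt_coe_iff, EReal.toReal_coe]
        refine exists_congr fun u => and_congr_right fun _ => and_congr_right fun hu => hiff u hu
      rw [spikeTime, hset]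
      by_cases hex : ∃ v : ℝ, 0 ≤ v ∧ ((j + 1 : ℕ) : ℝ) * Δ ≤ ξ₀ + ∫ σ in (0:ℝ)..v, f σ
      · right
        obtain ⟨v, hv, hvF⟩ := hex
        have hτv : τ < v := by
          by_contra h
          push Not at h
          have := hmono v τ hv h
          linarith
        have hcont : ContinuousOn (fun u => ξ₀ + ∫ σ in (0:ℝ)..u, f σ) (Set.Icc τ v) := by
          have h0 : ContinuousOn (fun u => ∫ σ in (0:ℝ)..u, f σ) (Set.uIcc 0 v) :=
            intervalIntegral.continuousOn_primitive_interval
              ((intervalIntegrable_iff' (by simp)).1 (hint 0 v le_rfl hv))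
          rw [Set.uIcc_of_le hv] at h0
          exact (continuousOn_const.add h0).mono (Set.Icc_subset_Icc_left hτ)
        have hScomp : IsCompact (Set.Icc τ v ∩ (fun u => ξ₀ + ∫ σ in (0:ℝ)..u, f σ) ⁻¹'
            (Set.Ici (((j + 1 : ℕ) : ℝ) * Δ))) :=
          isCompact_Icc.of_isClosed_subset
            (hcont.preimage_isClosed_of_isClosed isClosed_Icc isClosed_Ici)
            Set.inter_subset_left
        obtain ⟨w, ⟨hwI, hwF⟩, hwmin⟩ := hScomp.exists_isLeast ⟨v, ⟨hτv.le, le_rfl⟩, hvF⟩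
        simp only [Set.mem_preimage, Set.mem_Ici] at hwF
        have hτw : τ < w := by
          rcases hwI.1.lt_or_eq with h | h
          · exact h
          · subst h; linarith
        have hw0 : 0 ≤ w := hτ.trans hτw.le
        have hFw : ξ₀ + ∫ σ in (0:ℝ)..w, f σ = ((j + 1 : ℕ) : ℝ) * Δ := by
          obtain ⟨x, hx, hxF⟩ := intermediate_value_Icc hτw.le
            (hcont.mono (Set.Icc_subset_Icc_right hwI.2)) ⟨hFlt.le, hwF⟩
          have hxw : w ≤ x := hwmin ⟨⟨hx.1, hx.2.trans hwI.2⟩, hxF.ge⟩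
          have : x = w := le_antisymm hx.2 hxw
          subst this
          exact hxF
        refine ⟨w, hw0, ?_, by simpa using hFw, ?_⟩
        · apply le_antisymm
          · exact sInf_le ⟨w, rfl, hτw, hwF⟩
          · apply le_sInf
            rintro s ⟨u, rfl, hu, huF⟩
            rw [EReal.coe_le_coe_iff]
            by_contra h
            push Not at h
            have : w ≤ u := hwmin ⟨⟨hu.le, h.le.trans hwI.2⟩, huF⟩
            linarith
        · intro u hu huw
          by_contra h
          push Not at h
          have hτu : τ < u := by
            by_contra h'
            push Not at h'
            have := hmono u τ hu h'
            linarith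
          have : w ≤ u := hwmin ⟨⟨hτu.le, huw.le.trans hwI.2⟩, h⟩
          linarith
      · left
        push Not at hex
        refine ⟨by omega, ?_, hex⟩
        rw [sInf_eq_top]
        rintro s ⟨u, rfl, hu, huF⟩
        have := hex u (hτ.trans hu.le)
        linarith

theorem neuron_bound (hΔ : 0 < Δ) (hξ : ξ₀ ∈ Set.Ico 0 Δ) (hf : ∀ x, 0 ≤ f x)
    (hint : ∀ a b, 0 ≤ a → 0 ≤ b → IntervalIntegrable f volume a b) (t : ℝ) (ht : 0 ≤ t) :
    |(∫ σ in (0:ℝ)..t, f σ) - Δ * (spikeCount Δ ξ₀ f t : ℝ)| ≤ Δ := by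
  have hnn : ∀ a b : ℝ, a ≤ b → 0 ≤ ∫ σ in a..b, f σ := fun a b hab =>
    intervalIntegral.integral_nonneg hab (fun x _ => hf x)
  have hFn : 0 ≤ (ξ₀ + ∫ σ in (0:ℝ)..t, f σ) / Δ :=
    div_nonneg (add_nonneg hξ.1 (hnn 0 t ht)) hΔ.le
  have hset : {j : ℕ | 1 ≤ j ∧ spikeTime Δ ξ₀ f j ≤ (t : EReal)} =
      ↑(Finset.Icc 1 ⌊(ξ₀ + ∫ σ in (0:ℝ)..t, f σ) / Δ⌋₊) := by
    ext j
    simp only [Set.mem_ofPred_eq, Finset.coe_Icc, Set.mem_Icc]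
    refine and_congr_right fun hj => ?_
    rw [Nat.le_floor_iff hFn, le_div_iff₀ hΔ]
    rcases spike_char hΔ hξ hf hint j with ⟨_, htop, hlt⟩ | ⟨τ, hτ, hst, hF, hlt⟩
    · rw [htop]
      have := hlt t ht
      constructor
      · intro h; simp at h
      · intro h; linarith
    · rw [hst, EReal.coe_le_coe_iff]
      rw [if_neg (by omega)] at hF
      constructor
      · intro h
        have h1 := intervalIntegral.integral_add_adjacent_intervals
          (hint 0 τ le_rfl hτ) (hint τ t hτ ht)
        have := hnn τ t h
        linarith
      · intro h
        by_contra h'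
        push Not at h'
        have := hlt t ht h'
        linarith
  rw [spikeCount, hset, Set.ncard_coe_finset, Nat.card_Icc, Nat.add_sub_cancel]
  have h1 := Nat.floor_le hFn
  have h2 := Nat.lt_floor_add_one ((ξ₀ + ∫ σ in (0:ℝ)..t, f σ) / Δ)
  rw [le_div_iff₀ hΔ] at h1
  rw [div_lt_iff₀ hΔ] at h2
  have := hξ.1
  have := hξ.2
  rw [abs_le]
  constructor <;> nlinarith

end helpers

/-- Theorem 1, two-neuron network: with `K₁ = α₁/Δ₁`, `K₂ = α₂/Δ₂`, neuron 1 fed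
with `max(0, y)` and neuron 2 with `max(0, −y)`, the cumulative network output
`α₁N₁(t) − α₂N₂(t)` approximates `∫₀ᵗ (max(0,K₁y) − max(0,−K₂y))` to within `α₁ + α₂`. -/
theorem two_neuron_universal_approximation
    (K₁ K₂ α₁ α₂ Δ₁ Δ₂ ξ₁₀ ξ₂₀ : ℝ)
    (hK₁pos : 0 < K₁) (hK₂pos : 0 < K₂)
    (hα₁ : 0 < α₁) (hα₂ : 0 < α₂) (hΔ₁ : 0 < Δ₁) (hΔ₂ : 0 < Δ₂)
    (hK₁ : K₁ = α₁ / Δ₁) (hK₂ : K₂ = α₂ / Δ₂)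
    (hξ₁₀ : ξ₁₀ ∈ Set.Ico 0 Δ₁) (hξ₂₀ : ξ₂₀ ∈ Set.Ico 0 Δ₂)
    (y : ℝ → ℝ) (hy_meas : Measurable y)
    (hy_bdd : ∀ T : ℝ, 0 < T → ∃ M : ℝ, ∀ᵐ s ∂volume, s ∈ Set.Icc (0 : ℝ) T → |y s| ≤ M) :
    ∀ t : ℝ, 0 ≤ t →
      |(∫ s in (0 : ℝ)..t, (max 0 (K₁ * y s) - max 0 (-(K₂ * y s)))) -
          (α₁ * (spikeCount Δ₁ ξ₁₀ (fun s => max 0 (y s)) t : ℝ) -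
            α₂ * (spikeCount Δ₂ ξ₂₀ (fun s => max 0 (-y s)) t : ℝ))| ≤ α₁ + α₂ := by
  intro t ht
  have hyint : ∀ a b, 0 ≤ a → 0 ≤ b → IntervalIntegrable y volume a b := by
    intro a b ha hb
    obtain ⟨M, hM⟩ := hy_bdd (max a b + 1) (by positivity)
    rw [intervalIntegrable_iff]
    refine Measure.integrableOn_of_bounded (M := M) (by simp) hy_meas.aestronglyMeasurable ?_
    rw [ae_restrict_iff' measurableSet_uIoc]
    filter_upwards [hM] with s hs hmem
    rw [Set.uIoc, Set.mem_Ioc] at hmem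
    exact hs ⟨(le_min ha hb).trans hmem.1.le, by linarith [hmem.2]⟩
  have i1 : ∀ a b, 0 ≤ a → 0 ≤ b → IntervalIntegrable (fun s => max 0 (y s)) volume a b := by
    intro a b ha hb
    have := hyint a b ha hb
    rw [intervalIntegrable_iff] at this ⊢
    simpa only [max_comm, IntegrableOn] using this.pos_part
  have i2 : ∀ a b, 0 ≤ a → 0 ≤ b → IntervalIntegrable (fun s => max 0 (-y s)) volume a b := by
    intro a b ha hb
    have := hyint a b ha hb
    rw [intervalIntegrable_iff] at this ⊢
    simpa only [max_comm, IntegrableOn] using this.neg_part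
  have b1 := neuron_bound hΔ₁ hξ₁₀ (fun x => le_max_left 0 (y x)) i1 t ht
  have b2 := neuron_bound hΔ₂ hξ₂₀ (fun x => le_max_left 0 (-y x)) i2 t ht
  have heq : (∫ s in (0 : ℝ)..t, (max 0 (K₁ * y s) - max 0 (-(K₂ * y s)))) =
      K₁ * (∫ s in (0 : ℝ)..t, max 0 (y s)) - K₂ * ∫ s in (0 : ℝ)..t, max 0 (-y s) := by
    rw [← intervalIntegral.integral_const_mul, ← intervalIntegral.integral_const_mul,
      ← intervalIntegral.integral_sub ((i1 0 t le_rfl ht).const_mul _)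
        ((i2 0 t le_rfl ht).const_mul _)]
    congr 1
    ext s
    rw [mul_max_of_nonneg _ _ hK₁pos.le, mul_max_of_nonneg _ _ hK₂pos.le]
    simp
  have e1 : α₁ = K₁ * Δ₁ := by rw [hK₁]; field_simp
  have e2 : α₂ = K₂ * Δ₂ := by rw [hK₂]; field_simp
  rw [heq]
  clear hK₁ hK₂
  subst e1 e2
  rw [abs_le] at b1 b2 ⊢
  constructor <;> nlinarith [mul_le_mul_of_nonneg_left b1.1 hK₁pos.le,
    mul_le_mul_of_nonneg_left b1.2 hK₁pos.le, mul_le_mul_of_nonneg_left b2.1 hK₂pos.le,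
    mul_le_mul_of_nonneg_left b2.2 hK₂pos.le]
end

section
/- (Theorem 1, zero initial neuron states) Let K₁, K₂, α₁, α₂, Δ₁, Δ₂ > 0 with K₁ = α₁/Δ₁ and K₂ = α₂/Δ₂, and suppose both neurons start at initial state 0 (ξ₁₀ = ξ₂₀ = 0). Then for every measurable, locally essentially bounded signal y : [0,∞) → ℝ and all t ≥ 0, | ∫₀ᵗ ( max(0, K₁ y(s)) − max(0, −K₂ y(s)) ) ds − ( α₁ N₁(t) − α₂ N₂(t) ) | ≤ max(α₁, α₂). -/
open MeasureTheory

lemma spikeTime_nonneg_aux (Δ : ℝ) (f : ℝ → ℝ) (j : ℕ) : (0 : EReal) ≤ spikeTime Δ 0 f j := by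
  induction j with
  | zero => simp [spikeTime]
  | succ j ih =>
    rw [spikeTime]
    apply le_sInf
    rintro s ⟨u, rfl, hu, -⟩
    exact ih.trans hu.le

lemma spikeTime_le_iff_aux (Δ : ℝ) (hΔ : 0 < Δ) (f F : ℝ → ℝ) (hF : Continuous F)
    (hm : Monotone F) (h0 : F 0 = 0)
    (hint : ∀ r u : ℝ, 0 ≤ r → r ≤ u → ∫ σ in r..u, f σ = F u - F r) (j : ℕ) :
    ∀ t : ℝ, 0 ≤ t → (spikeTime Δ 0 f j ≤ (t : EReal) ↔ (j : ℝ) * Δ ≤ F t) := by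
  induction j with
  | zero =>
    intro t ht
    have : 0 ≤ F t := h0 ▸ hm ht
    simp [spikeTime, ht, this]
  | succ j ih =>
    intro t ht
    have hnn := spikeTime_nonneg_aux Δ f j
    rw [spikeTime]
    simp only [ite_self, zero_add]
    generalize hτ : spikeTime Δ 0 f j = τ at *
    induction τ using EReal.rec with
    | bot => simp at hnn
    | top =>
      have h1 := ih t ht
      simp only [top_le_iff, EReal.coe_ne_top, false_iff, not_le] at h1
      constructor
      · intro h
        simp at h
      · intro h
        push_cast at h
        exfalso
        linarith
    | coe r =>
      have hr : 0 ≤ r := by exact_mod_cast hnn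
      simp only [EReal.toReal_coe, EReal.coe_lt_coe_iff, EReal.coe_le_coe_iff] at ih ⊢
      have hFr : F r = j * Δ := by
        apply le_antisymm _ ((ih r hr).1 le_rfl)
        by_contra hc
        push Not at hc
        have hjΔ : 0 ≤ (j : ℝ) * Δ := by positivity
        have hr0 : 0 < r := by
          rcases hr.lt_or_eq with h | h
          · exact h
          · rw [← h, h0] at hc; linarith
        have e1 : ∀ᶠ x in nhdsWithin r (Set.Iio r), (j : ℝ) * Δ < F x :=
          (hF.continuousAt.eventually (lt_mem_nhds hc)).filter_mono nhdsWithin_le_nhds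
        have e2 : ∀ᶠ x in nhdsWithin r (Set.Iio r), 0 < x :=
          (lt_mem_nhds hr0).filter_mono nhdsWithin_le_nhds
        have e3 : ∀ᶠ x in nhdsWithin r (Set.Iio r), x < r := self_mem_nhdsWithin
        obtain ⟨x, hx1, hx2, hx3⟩ := (e1.and (e2.and e3)).exists
        exact absurd ((ih x hx2.le).2 hx1.le) (not_le.2 hx3)
      push_cast
      constructor
      · intro h
        by_contra hc
        push Not at hc
        have e1 : ∀ᶠ x in nhdsWithin t (Set.Ioi t), F x < ((j : ℝ) + 1) * Δ :=
          (hF.continuousAt.eventually (gt_mem_nhds hc)).filter_mono nhdsWithin_le_nhds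
        have e3 : ∀ᶠ x in nhdsWithin t (Set.Ioi t), t < x := self_mem_nhdsWithin
        obtain ⟨x, hx1, hx2⟩ := (e1.and e3).exists
        have : (x : EReal) ≤ (t : EReal) := by
          refine le_trans (le_sInf ?_) h
          rintro s ⟨u, rfl, hu, hu2⟩
          rw [hint r u hr hu.le, hFr] at hu2
          by_contra hxu
          have hxu' : u ≤ x := by
            push Not at hxu
            exact_mod_cast hxu.le
          have := hm hxu'
          nlinarith
        have : x ≤ t := by exact_mod_cast this
        linarith
      · intro h
        have hrt : r < t := by
          by_contra hc
          have := hm (not_lt.1 hc)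
          nlinarith
        refine sInf_le ⟨t, rfl, hrt, ?_⟩
        rw [hint r t hr hrt.le, hFr]
        linarith

lemma spikeCount_aux (Δ : ℝ) (hΔ : 0 < Δ) (f F : ℝ → ℝ) (hF : Continuous F)
    (hm : Monotone F) (h0 : F 0 = 0)
    (hint : ∀ r u : ℝ, 0 ≤ r → r ≤ u → ∫ σ in r..u, f σ = F u - F r) (t : ℝ) (ht : 0 ≤ t) :
    spikeCount Δ 0 f t = ⌊F t / Δ⌋₊ := by
  have hFt : 0 ≤ F t := h0 ▸ hm ht
  have : {j : ℕ | 1 ≤ j ∧ spikeTime Δ 0 f j ≤ (t : EReal)}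
      = ((Finset.Icc 1 ⌊F t / Δ⌋₊ : Finset ℕ) : Set ℕ) := by
    ext j
    simp only [Set.mem_setOf_eq, Finset.coe_Icc, Set.mem_Icc]
    rw [spikeTime_le_iff_aux Δ hΔ f F hF hm h0 hint j t ht, Nat.le_floor_iff (by positivity),
      le_div_iff₀ hΔ]
  rw [spikeCount, this, Set.ncard_coe_finset]
  simp

lemma spikeCount_bounds_aux (Δ : ℝ) (hΔ : 0 < Δ) (f : ℝ → ℝ) (hnn : ∀ s, 0 ≤ f s)
    (hf : ∀ T : ℝ, 0 < T → IntegrableOn f (Set.Icc 0 T)) (t : ℝ) (ht : 0 ≤ t) :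
    Δ * (spikeCount Δ 0 f t : ℝ) ≤ ∫ s in (0 : ℝ)..t, f s ∧
      ∫ s in (0 : ℝ)..t, f s ≤ Δ * (spikeCount Δ 0 f t : ℝ) + Δ := by
  set g : ℝ → ℝ := Set.indicator (Set.Ici 0) f with hg
  have hgnn : ∀ s, 0 ≤ g s := fun s => Set.indicator_nonneg (fun x _ => hnn x) s
  have hgi : ∀ a b : ℝ, IntervalIntegrable g volume a b := by
    intro a b
    have h1 : IntegrableOn f (Set.Icc 0 (max 1 (max a b))) := hf _ (by positivity)
    have h2 : IntegrableOn g (Set.uIcc a b) := by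
      rw [hg, IntegrableOn, integrable_indicator_iff measurableSet_Ici, IntegrableOn,
        Measure.restrict_restrict measurableSet_Ici]
      apply h1.mono_set
      rintro x ⟨hx, hx2⟩
      exact ⟨hx, hx2.2.trans (le_max_right _ _)⟩
    exact h2.intervalIntegrable
  set F : ℝ → ℝ := fun u => ∫ s in (0 : ℝ)..u, g s with hFdef
  have hF : Continuous F := intervalIntegral.continuous_primitive hgi 0
  have hsub : ∀ r u : ℝ, ∫ σ in r..u, g σ = F u - F r := fun r u =>
    (intervalIntegral.integral_interval_sub_left (hgi 0 u) (hgi 0 r)).symm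
  have hm : Monotone F := by
    intro a b hab
    have := hsub a b
    have h2 : 0 ≤ ∫ σ in a..b, g σ := intervalIntegral.integral_nonneg hab (fun x _ => hgnn x)
    linarith
  have h0 : F 0 = 0 := by simp [hFdef]
  have hint : ∀ r u : ℝ, 0 ≤ r → r ≤ u → ∫ σ in r..u, f σ = F u - F r := by
    intro r u hr hru
    rw [← hsub r u]
    apply intervalIntegral.integral_congr
    intro x hx
    rw [Set.uIcc_of_le hru] at hx
    have : x ∈ Set.Ici (0 : ℝ) := hr.trans hx.1
    simp [hg, Set.indicator_of_mem this]
  have hFt : 0 ≤ F t := h0 ▸ hm ht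
  rw [spikeCount_aux Δ hΔ f F hF hm h0 hint t ht, hint 0 t le_rfl ht, h0, sub_zero]
  have h1 := Nat.floor_le (a := F t / Δ) (by positivity)
  have h2 := (Nat.lt_floor_add_one (F t / Δ)).le
  rw [le_div_iff₀ hΔ] at h1
  rw [div_le_iff₀ hΔ] at h2
  constructor <;> linarith

/-- Theorem 1, zero initial neuron states: if both neurons start at state `0`,
the approximation bound improves to `max(α₁, α₂)`. -/
theorem two_neuron_universal_approximation_zero_init
    (K₁ K₂ α₁ α₂ Δ₁ Δ₂ : ℝ)
    (hK₁pos : 0 < K₁) (hK₂pos : 0 < K₂)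
    (hα₁ : 0 < α₁) (hα₂ : 0 < α₂) (hΔ₁ : 0 < Δ₁) (hΔ₂ : 0 < Δ₂)
    (hK₁ : K₁ = α₁ / Δ₁) (hK₂ : K₂ = α₂ / Δ₂)
    (y : ℝ → ℝ) (hy_meas : Measurable y)
    (hy_bdd : ∀ T : ℝ, 0 < T → ∃ M : ℝ, ∀ᵐ s ∂volume, s ∈ Set.Icc (0 : ℝ) T → |y s| ≤ M) :
    ∀ t : ℝ, 0 ≤ t →
      |(∫ s in (0 : ℝ)..t, (max 0 (K₁ * y s) - max 0 (-(K₂ * y s)))) -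
          (α₁ * (spikeCount Δ₁ 0 (fun s => max 0 (y s)) t : ℝ) -
            α₂ * (spikeCount Δ₂ 0 (fun s => max 0 (-y s)) t : ℝ))| ≤ max α₁ α₂ := by
  intro t ht
  have hyi : ∀ T : ℝ, 0 < T → IntegrableOn y (Set.Icc 0 T) := by
    intro T hT
    obtain ⟨M, hM⟩ := hy_bdd T hT
    refine Measure.integrableOn_of_bounded (M := M) (by simp) hy_meas.aestronglyMeasurable ?_
    rw [ae_restrict_iff' measurableSet_Icc]
    exact hM
  have hf1 : ∀ T : ℝ, 0 < T → IntegrableOn (fun s => max 0 (y s)) (Set.Icc 0 T) := fun T hT =>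
    (integrable_zero _ _ _).sup (hyi T hT)
  have hf2 : ∀ T : ℝ, 0 < T → IntegrableOn (fun s => max 0 (-y s)) (Set.Icc 0 T) := fun T hT =>
    (integrable_zero _ _ _).sup (hyi T hT).neg
  obtain ⟨a1, b1⟩ := spikeCount_bounds_aux Δ₁ hΔ₁ (fun s => max 0 (y s))
    (fun s => le_max_left _ _) hf1 t ht
  obtain ⟨a2, b2⟩ := spikeCount_bounds_aux Δ₂ hΔ₂ (fun s => max 0 (-y s))
    (fun s => le_max_left _ _) hf2 t ht
  have hii : ∀ f : ℝ → ℝ, (∀ T : ℝ, 0 < T → IntegrableOn f (Set.Icc 0 T)) →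
      IntervalIntegrable f volume 0 t := by
    intro f hf
    rw [intervalIntegrable_iff_integrableOn_Icc_of_le ht]
    exact (hf (t + 1) (by linarith)).mono_set (Set.Icc_subset_Icc_right (by linarith))
  have hI : (∫ s in (0 : ℝ)..t, (max 0 (K₁ * y s) - max 0 (-(K₂ * y s))))
      = K₁ * (∫ s in (0 : ℝ)..t, max 0 (y s)) - K₂ * ∫ s in (0 : ℝ)..t, max 0 (-y s) := by
    rw [← intervalIntegral.integral_const_mul, ← intervalIntegral.integral_const_mul,
      ← intervalIntegral.integral_sub ((hii _ hf1).const_mul _) ((hii _ hf2).const_mul _)]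
    congr 1
    ext s
    rw [mul_max_of_nonneg _ _ hK₁pos.le, mul_max_of_nonneg _ _ hK₂pos.le]
    simp
  rw [hI]
  have e1 : K₁ * Δ₁ = α₁ := by rw [hK₁]; field_simp
  have e2 : K₂ * Δ₂ = α₂ := by rw [hK₂]; field_simp
  have a1' := mul_le_mul_of_nonneg_left a1 hK₁pos.le
  have b1' := mul_le_mul_of_nonneg_left b1 hK₁pos.le
  have a2' := mul_le_mul_of_nonneg_left a2 hK₂pos.le
  have b2' := mul_le_mul_of_nonneg_left b2 hK₂pos.le
  rw [← mul_assoc, e1] at a1'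
  rw [mul_add, ← mul_assoc, e1] at b1'
  rw [← mul_assoc, e2] at a2'
  rw [mul_add, ← mul_assoc, e2] at b2'
  have m1 := le_max_left α₁ α₂
  have m2 := le_max_right α₁ α₂
  rw [abs_le]
  constructor <;> linarith
end

section
/- (Proposition 1, dwell time) Let T > 0 and M > 0, and suppose the input of an integrate-and-fire neuron satisfies f(σ) ≤ M for almost every σ ∈ [0, T]. Then any two consecutive spike times contained in [0, T] after the first spike are separated by at least Δ/M: for every j ≥ 1 with t_{j+1} ≤ T one has t_{j+1} − t_j ≥ Δ/M; moreover, if t₁ ≤ T then t₁ ≥ (Δ − ξ₀)/M. -/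
open MeasureTheory

theorem dwell_aux (f : ℝ → ℝ) (T M a c : ℝ) (hM : 0 < M) (ha : 0 ≤ a) (hc : 0 < c)
    (hf_nonneg : ∀ σ, 0 ≤ f σ)
    (hf_bdd : ∀ᵐ σ ∂volume, σ ∈ Set.Icc (0 : ℝ) T → f σ ≤ M) (r : ℝ) (har : a ≤ r) (hrT : r ≤ T)
    (hlow : ∀ u : ℝ, a < u → c ≤ ∫ σ in a..u, f σ → r ≤ u)
    (happ : ∀ x : ℝ, r < x → ∃ u : ℝ, u < x ∧ a < u ∧ c ≤ ∫ σ in a..u, f σ) :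
    c / M ≤ r - a := by
  rw [div_le_iff₀ hM]
  by_contra hcon
  push Not at hcon
  obtain ⟨u0, -, hau0, hu0⟩ := happ (r + 1) (by linarith)
  have hint : IntervalIntegrable f volume a u0 := by
    by_contra h
    rw [intervalIntegral.integral_undef h] at hu0
    linarith
  have hr0 : r ≤ u0 := hlow u0 hau0 hu0
  have hcont : ContinuousOn (fun u => ∫ σ in a..u, f σ) (Set.uIcc a u0) :=
    intervalIntegral.continuousOn_primitive_interval' hint Set.left_mem_uIcc
  rw [Set.uIcc_of_le hau0.le] at hcont
  have hGr : ∫ σ in a..r, f σ < c := by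
    have hintr : IntervalIntegrable f volume a r :=
      hint.mono_set (by
        rw [Set.uIcc_of_le har, Set.uIcc_of_le hau0.le]
        exact Set.Icc_subset_Icc_right hr0)
    have : ∫ σ in a..r, f σ ≤ ∫ σ in a..r, M := by
      apply intervalIntegral.integral_mono_ae_restrict har hintr (by simp)
      rw [Filter.EventuallyLE, ae_restrict_iff' measurableSet_Icc]
      filter_upwards [hf_bdd] with x hx hx2
      exact hx ⟨ha.trans hx2.1, hx2.2.trans hrT⟩
    simp at this
    linarith
  have hev := (hcont r ⟨har, hr0⟩).eventually_lt_const hGr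
  rw [eventually_nhdsWithin_iff, Metric.eventually_nhds_iff] at hev
  obtain ⟨ε, hε, hev⟩ := hev
  obtain ⟨u1, hu1, hau1, hcu1⟩ := happ (r + ε) (by linarith)
  have hr1 : r ≤ u1 := hlow u1 hau1 hcu1
  rcases le_total u1 u0 with h | h
  · have := hev (y := u1) (by rw [Real.dist_eq, abs_lt]; constructor <;> linarith) ⟨hau1.le, h⟩
    linarith
  · have := hev (y := u0) (by rw [Real.dist_eq, abs_lt]; constructor <;> linarith) ⟨hau0.le, le_rfl⟩
    linarith

theorem spikeTime_le_succ (Δ ξ₀ : ℝ) (f : ℝ → ℝ) (j : ℕ) :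
    spikeTime Δ ξ₀ f j ≤ spikeTime Δ ξ₀ f (j + 1) := by
  rw [spikeTime]
  refine le_sInf ?_
  rintro s ⟨u, rfl, hu, -⟩
  exact hu.le

theorem spikeTime_nonneg (Δ ξ₀ : ℝ) (f : ℝ → ℝ) (j : ℕ) : 0 ≤ spikeTime Δ ξ₀ f j := by
  induction j with
  | zero => simp [spikeTime]
  | succ j ih => exact ih.trans (spikeTime_le_succ Δ ξ₀ f j)

theorem dwell_step (Δ ξ₀ : ℝ) (f : ℝ → ℝ) (hΔ : 0 < Δ) (hξ₀ : ξ₀ ∈ Set.Ico 0 Δ)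
    (hf_nonneg : ∀ σ, 0 ≤ f σ) (T M : ℝ) (hM : 0 < M)
    (hf_bdd : ∀ᵐ σ ∂volume, σ ∈ Set.Icc (0 : ℝ) T → f σ ≤ M) (j : ℕ)
    (h : spikeTime Δ ξ₀ f (j + 1) ≤ (T : EReal)) :
    (Δ - if j = 0 then ξ₀ else 0) / M ≤
      (spikeTime Δ ξ₀ f (j + 1)).toReal - (spikeTime Δ ξ₀ f j).toReal := by
  have hmono := spikeTime_le_succ Δ ξ₀ f j
  have h0 := spikeTime_nonneg Δ ξ₀ f j
  have key : ∀ x : EReal, 0 ≤ x → x ≤ T → ∃ y : ℝ, x = y := fun x h1 h2 =>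
    ⟨x.toReal, (EReal.coe_toReal (ne_top_of_le_ne_top (EReal.coe_ne_top T) h2)
      (ne_bot_of_le_ne_bot (EReal.coe_ne_bot 0) h1)).symm⟩
  obtain ⟨a, ha⟩ := key _ h0 (hmono.trans h)
  obtain ⟨r, hr⟩ := key _ (h0.trans hmono) h
  have hdef := hr
  rw [spikeTime] at hdef
  rw [hr] at h hmono
  rw [ha] at h0 hmono
  simp only [ha, EReal.toReal_coe, EReal.coe_lt_coe_iff] at hdef
  rw [hr, ha, EReal.toReal_coe, EReal.toReal_coe]
  refine dwell_aux f T M a _ hM (by exact_mod_cast h0) ?_ hf_nonneg hf_bdd r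
    (by exact_mod_cast hmono) (by exact_mod_cast h) ?_ ?_
  · split_ifs
    · linarith [hξ₀.2]
    · linarith
  · intro u hu hc
    rw [← EReal.coe_le_coe_iff, ← hdef]
    exact sInf_le ⟨u, rfl, hu, by linarith⟩
  · intro x hx
    rw [← EReal.coe_lt_coe_iff, ← hdef, sInf_lt_iff] at hx
    obtain ⟨s, ⟨u, rfl, hu, hc⟩, hs⟩ := hx
    exact ⟨u, by exact_mod_cast hs, hu, by linarith⟩

/-- Proposition 1, dwell time: if `f ≤ M` a.e. on `[0,T]`, then consecutive spike
times inside `[0,T]` after the first spike are separated by at least `Δ/M`, and the first spike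
time (if `≤ T`) is at least `(Δ − ξ₀)/M`. -/
theorem spike_dwell_time
    (Δ ξ₀ : ℝ) (hΔ : 0 < Δ) (hξ₀ : ξ₀ ∈ Set.Ico 0 Δ)
    (f : ℝ → ℝ) (hf_meas : Measurable f) (hf_nonneg : ∀ σ, 0 ≤ f σ)
    (T M : ℝ) (hT : 0 < T) (hM : 0 < M)
    (hf_bdd : ∀ᵐ σ ∂volume, σ ∈ Set.Icc (0 : ℝ) T → f σ ≤ M) :
    (∀ j : ℕ, 1 ≤ j → spikeTime Δ ξ₀ f (j + 1) ≤ (T : EReal) →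
        Δ / M ≤ (spikeTime Δ ξ₀ f (j + 1)).toReal - (spikeTime Δ ξ₀ f j).toReal) ∧
    (spikeTime Δ ξ₀ f 1 ≤ (T : EReal) → (Δ - ξ₀) / M ≤ (spikeTime Δ ξ₀ f 1).toReal) := by
  constructor
  · intro j hj h
    have := dwell_step Δ ξ₀ f hΔ hξ₀ hf_nonneg T M hM hf_bdd j h
    rwa [if_neg (by omega), sub_zero] at this
  · intro h
    have := dwell_step Δ ξ₀ f hΔ hξ₀ hf_nonneg T M hM hf_bdd 0 h
    simpa [spikeTime] using this
end

section
/- (Proposition 1, no Zeno behavior) If the input f of an integrate-and-fire neuron is measurable, nonnegative, and locally essentially bounded (for every T > 0 there is M_T > 0 with f(σ) ≤ M_T for almost every σ ∈ [0, T]), then the sequence of spike times (t_j) either contains only finitely many finite terms, or satisfies t_j → +∞ as j → ∞; in particular, spike times cannot accumulate at any finite time. -/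
open MeasureTheory

theorem spikeTime_lower_bound
    (Δ ξ₀ : ℝ) (hΔ : 0 < Δ) (hξ₀ : ξ₀ ∈ Set.Ico 0 Δ)
    (f : ℝ → ℝ) (hf_nonneg : ∀ σ, 0 ≤ f σ) (T M : ℝ) (hT : 0 < T) (hM : 0 < M)
    (hb : ∀ᵐ σ ∂volume, σ ∈ Set.Icc (0 : ℝ) T → f σ ≤ M) (j : ℕ) :
    ((min (j * ((Δ - ξ₀) / M)) T : ℝ) : EReal) ≤ spikeTime Δ ξ₀ f j := by
  obtain ⟨h0, h1⟩ := hξ₀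
  have hc : 0 < (Δ - ξ₀) / M := div_pos (by linarith) hM
  induction j with
  | zero => simp [spikeTime, hT.le]
  | succ j ih =>
    rw [spikeTime]
    refine le_sInf ?_
    rintro s ⟨u, rfl, hu, hint⟩
    rw [EReal.coe_le_coe_iff]
    rcases le_or_gt T u with hTu | hTu
    · exact (min_le_right _ _).trans hTu
    refine (min_le_left _ _).trans ?_
    generalize spikeTime Δ ξ₀ f j = t at *
    induction t with
    | bot => simp at ih
    | top => simp at hu
    | coe a =>
      rw [EReal.coe_le_coe_iff] at ih
      rw [EReal.coe_lt_coe_iff] at hu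
      rw [EReal.toReal_coe] at hint
      have hja : j * ((Δ - ξ₀) / M) ≤ a := by
        rcases min_le_iff.1 ih with h | h
        · exact h
        · linarith
      have ha : 0 ≤ a := le_trans (by positivity) hja
      have hI := intervalIntegral.norm_integral_le_of_norm_le_const_ae
        (a := a) (b := u) (f := f) (C := M) (by
          filter_upwards [hb] with σ hσ hmem
          rw [Set.uIoc_of_le hu.le] at hmem
          rw [Real.norm_of_nonneg (hf_nonneg σ)]
          exact hσ ⟨by linarith [hmem.1], by linarith [hmem.2]⟩)
      rw [abs_of_pos (sub_pos.2 hu)] at hI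
      have hI2 := (le_abs_self _).trans hI
      have hif : (if j = 0 then ξ₀ else 0) ≤ ξ₀ := by split_ifs <;> linarith
      have : (Δ - ξ₀) / M ≤ u - a := by
        rw [div_le_iff₀ hM]
        linarith
      push_cast
      linarith

theorem spikeTime_eventually_gt
    (Δ ξ₀ : ℝ) (hΔ : 0 < Δ) (hξ₀ : ξ₀ ∈ Set.Ico 0 Δ)
    (f : ℝ → ℝ) (hf_nonneg : ∀ σ, 0 ≤ f σ)
    (hf_bdd : ∀ T : ℝ, 0 < T →
      ∃ M : ℝ, 0 < M ∧ ∀ᵐ σ ∂volume, σ ∈ Set.Icc (0 : ℝ) T → f σ ≤ M) (T : ℝ) :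
    ∀ᶠ j in Filter.atTop, (T : EReal) < spikeTime Δ ξ₀ f j := by
  have hT : 0 < |T| + 1 := by positivity
  obtain ⟨M, hM, hb⟩ := hf_bdd _ hT
  have hc : 0 < (Δ - ξ₀) / M := div_pos (by linarith [hξ₀.2]) hM
  have ht := (tendsto_natCast_atTop_atTop (R := ℝ)).atTop_mul_const hc
  filter_upwards [ht.eventually_gt_atTop T] with j hj
  refine lt_of_lt_of_le ?_ (spikeTime_lower_bound Δ ξ₀ hΔ hξ₀ f hf_nonneg _ M hT hM hb j)
  rw [EReal.coe_lt_coe_iff]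
  exact lt_min hj (by linarith [le_abs_self T])

/-- Proposition 1, no Zeno behavior: for a measurable, nonnegative, locally
essentially bounded input, the spike-time sequence either has only finitely many finite terms or
tends to `+∞`; in particular spike times cannot accumulate at any finite time. -/
theorem no_zeno_behavior
    (Δ ξ₀ : ℝ) (hΔ : 0 < Δ) (hξ₀ : ξ₀ ∈ Set.Ico 0 Δ)
    (f : ℝ → ℝ) (hf_meas : Measurable f) (hf_nonneg : ∀ σ, 0 ≤ f σ)
    (hf_bdd : ∀ T : ℝ, 0 < T →
      ∃ M : ℝ, 0 < M ∧ ∀ᵐ σ ∂volume, σ ∈ Set.Icc (0 : ℝ) T → f σ ≤ M) :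
    ({j : ℕ | spikeTime Δ ξ₀ f j ≠ ⊤}.Finite ∨
        Filter.Tendsto (spikeTime Δ ξ₀ f) Filter.atTop (nhds ⊤)) ∧
    ∀ T : ℝ, {j : ℕ | 1 ≤ j ∧ spikeTime Δ ξ₀ f j ≤ (T : EReal)}.Finite := by
  have key := spikeTime_eventually_gt Δ ξ₀ hΔ hξ₀ f hf_nonneg hf_bdd
  refine ⟨Or.inr (EReal.tendsto_nhds_top_iff_real.2 key), fun T => ?_⟩
  obtain ⟨N, hN⟩ := Filter.eventually_atTop.1 (key T)
  refine (Set.finite_lt_nat N).subset ?_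
  rintro j ⟨-, hj⟩
  by_contra h
  exact absurd hj (not_le.2 (hN j (not_lt.1 h)))
end

section
/- (Theorem 4, spiking approximation of continuous piecewise-affine functions) Let g be the piecewise-affine function determined by N ≥ 1, breakpoints b₁ ≤ ⋯ ≤ b_N, constant c and slopes K₀, …, K_N. Set K̄₀ = K₀, K̄₁ = K₁ and K̄_i = K_i − K_{i−1} for 2 ≤ i ≤ N. For each i ∈ {0, …, N} choose Δ_i > 0, set α_i = |K̄_i| Δ_i, and choose 𝒢_i ∈ {−1, 1} with 𝒢₀ = −sign(K̄₀) and 𝒢_i = sign(K̄_i) for 1 ≤ i ≤ N (arbitrary when K̄_i = 0); also choose α_{N+1} = Δ_{N+1} > 0 and α_{N+2} = Δ_{N+2} > 0 and set 𝒢_{N+1} = 1, 𝒢_{N+2} = −1. Given a measurable, locally essentially bounded signal y : [0,∞) → ℝ, let N_i(t) for i ∈ {0, …, N+2} be the spike counts of the integrate-and-fire neurons with thresholds Δ_i, initial states ξ_{i,0} ∈ [0, Δ_i), and inputs: max(0, −(y(·) − b₁)) for i = 0; max(0, y(·) − b_i) for 1 ≤ i ≤ N; max(0, c) for i = N+1;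 max(0, −c) for i = N+2. Then for all t ≥ 0, | ∫₀ᵗ g(y(s)) ds − Σ_{i=0}^{N+2} 𝒢_i α_i N_i(t) | ≤ Σ_{i=0}^{N+2} α_i. -/
open MeasureTheory

/-- The continuous piecewise-affine function with breakpoints `b 1 ≤ … ≤ b N`, value `c` at
`b 1`, and slopes `K 0, …, K N`:
`g(y) = c − K₀ max(0, −(y − b₁)) + K₁ max(0, y − b₁) + Σ_{i=2}^{N} (K i − K (i−1)) max(0, y − b i)`. -/
noncomputable def pwa (N : ℕ) (b K : ℕ → ℝ) (c : ℝ) (y : ℝ) : ℝ :=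
  c - K 0 * max 0 (-(y - b 1)) + K 1 * max 0 (y - b 1) +
    ∑ i ∈ Finset.Icc 2 N, (K i - K (i - 1)) * max 0 (y - b i)

/-- Characterisation of the spike times through the primitive of the input. -/
theorem spikeTime_char (Δ ξ : ℝ) (f : ℝ → ℝ) (hΔ : 0 < Δ) (hξ : ξ ∈ Set.Ico 0 Δ)
    (hf0 : ∀ s, 0 ≤ f s) (hfi : ∀ T : ℝ, 0 ≤ T → IntervalIntegrable f volume 0 T) (j : ℕ) :
    (spikeTime Δ ξ f j = ⊤ ∧ ∀ t : ℝ, 0 ≤ t → ξ + (∫ s in (0 : ℝ)..t, f s) < j * Δ) ∨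
    ∃ τ : ℝ, 0 ≤ τ ∧ spikeTime Δ ξ f j = (τ : EReal) ∧ (j = 0 → τ = 0) ∧
      (j ≠ 0 → ξ + (∫ s in (0 : ℝ)..τ, f s) = j * Δ ∧
        ∀ t : ℝ, 0 ≤ t → t < τ → ξ + (∫ s in (0 : ℝ)..t, f s) < j * Δ) := by
  have hadd : ∀ a u : ℝ, 0 ≤ a → 0 ≤ u →
      (∫ s in a..u, f s) = (∫ s in (0 : ℝ)..u, f s) - ∫ s in (0 : ℝ)..a, f s := by
    intro a u ha hu
    rw [intervalIntegral.integral_interval_sub_left (hfi u hu) (hfi a ha)]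
  have hmono : ∀ a u : ℝ, 0 ≤ a → a ≤ u →
      (∫ s in (0 : ℝ)..a, f s) ≤ ∫ s in (0 : ℝ)..u, f s := by
    intro a u ha hau
    have h1 := hadd a u ha (ha.trans hau)
    have h2 : 0 ≤ ∫ s in a..u, f s := intervalIntegral.integral_nonneg hau (fun s _ => hf0 s)
    linarith
  induction j with
  | zero =>
    right
    exact ⟨0, le_rfl, by simp [spikeTime], fun _ => rfl, fun h => absurd rfl h⟩
  | succ j ih =>
    rcases ih with ⟨htop, hlt⟩ | ⟨τ, hτ0, hτ, hj0, hj⟩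
    · left
      refine ⟨?_, fun t ht => ?_⟩
      · rw [spikeTime, htop, sInf_eq_top]
        rintro s ⟨u, -, hu, -⟩
        exact absurd hu not_top_lt
      · have := hlt t ht
        push_cast
        linarith
    · have hset : {s : EReal | ∃ u : ℝ, s = (u : EReal) ∧
          spikeTime Δ ξ f j < (u : EReal) ∧
          Δ ≤ (if j = 0 then ξ else 0) + ∫ σ in (spikeTime Δ ξ f j).toReal..u, f σ}
          = {s : EReal | ∃ u : ℝ, s = (u : EReal) ∧ 0 ≤ u ∧
            ((j + 1 : ℕ) : ℝ) * Δ ≤ ξ + ∫ s in (0 : ℝ)..u, f s} := by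
        have key : ∀ u : ℝ, 0 ≤ u →
            (if j = 0 then ξ else 0) + (∫ σ in τ..u, f σ)
              = ξ + (∫ s in (0 : ℝ)..u, f s) - j * Δ := by
          intro u hu
          rw [hadd τ u hτ0 hu]
          by_cases h : j = 0
          · rw [hj0 h]; simp [h]
          · have := (hj h).1
            simp only [h, if_false]
            linarith
        ext s
        constructor
        · rintro ⟨u, rfl, hu, hle⟩
          rw [hτ, EReal.coe_lt_coe_iff] at hu
          rw [hτ, EReal.toReal_coe, key u (by linarith)] at hle
          refine ⟨u, rfl, by linarith, ?_⟩
          push_cast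
          linarith
        · rintro ⟨u, rfl, hu, hle⟩
          refine ⟨u, rfl, ?_, ?_⟩
          · rw [hτ, EReal.coe_lt_coe_iff]
            by_contra hcon
            have h1 := hmono u τ hu (not_lt.mp hcon)
            push_cast at hle
            by_cases h : j = 0
            · have h2 := hj0 h
              have h3 := hξ.2
              subst h
              subst h2
              simp at h1 hle
              linarith
            · have := (hj h).1
              linarith
          · rw [hτ, EReal.toReal_coe, key u hu]
            push_cast at hle
            linarith
      rw [spikeTime, hset]
      by_cases hne : ∃ T : ℝ, 0 ≤ T ∧ ((j + 1 : ℕ) : ℝ) * Δ ≤ ξ + ∫ s in (0 : ℝ)..T, f s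
      · right
        obtain ⟨T, hT0, hT⟩ := hne
        have hcont : ContinuousOn (fun u => ξ + ∫ s in (0 : ℝ)..u, f s) (Set.Icc 0 T) := by
          have := intervalIntegral.continuousOn_primitive_interval' (hfi T hT0)
            (Set.left_mem_uIcc)
          rw [Set.uIcc_of_le hT0] at this
          exact continuousOn_const.add this
        have hcomp : IsCompact (Set.Icc 0 T ∩
            (fun u => ξ + ∫ s in (0 : ℝ)..u, f s) ⁻¹' Set.Ici (((j + 1 : ℕ) : ℝ) * Δ)) :=
          isCompact_Icc.of_isClosed_subset
            (hcont.preimage_isClosed_of_isClosed isClosed_Icc isClosed_Ici)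
            Set.inter_subset_left
        obtain ⟨m, ⟨⟨hm0, hmT⟩, hm⟩, hleast⟩ := hcomp.exists_isLeast ⟨T, ⟨hT0, le_rfl⟩, hT⟩
        simp only [Set.mem_preimage, Set.mem_Ici] at hm
        have hlt : ∀ t : ℝ, 0 ≤ t → t < m →
            ξ + (∫ s in (0 : ℝ)..t, f s) < ((j + 1 : ℕ) : ℝ) * Δ := by
          intro t ht htm
          by_contra hcon
          exact absurd (hleast ⟨⟨ht, by linarith⟩, not_lt.mp hcon⟩) (not_le.mpr htm)
        refine ⟨m, hm0, ?_, fun h => absurd h (Nat.succ_ne_zero j), fun _ => ⟨?_, hlt⟩⟩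
        · apply IsLeast.csInf_eq
          refine ⟨⟨m, rfl, hm0, hm⟩, ?_⟩
          rintro s ⟨u, rfl, hu, hle⟩
          rw [EReal.coe_le_coe_iff]
          by_contra hcon
          exact absurd hle (not_le.mpr (hlt u hu (not_le.mp hcon)))
        · have hivt := intermediate_value_Icc hm0
            (hcont.mono (Set.Icc_subset_Icc_right hmT))
          have hmem : ((j + 1 : ℕ) : ℝ) * Δ ∈ Set.Icc
              (ξ + ∫ s in (0 : ℝ)..0, f s) (ξ + ∫ s in (0 : ℝ)..m, f s) := by
            refine ⟨?_, hm⟩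
            rw [intervalIntegral.integral_same]
            have h3 := hξ.2
            have : 0 ≤ (j : ℝ) * Δ := by positivity
            push_cast
            linarith
          obtain ⟨u, ⟨hu0, hum⟩, hu⟩ := hivt hmem
          simp only at hu
          rcases hum.lt_or_eq with h | h
          · have := hlt u hu0 h
            linarith
          · rw [← h]; exact hu
      · left
        push Not at hne
        refine ⟨?_, hne⟩
        rw [sInf_eq_top]
        rintro s ⟨u, -, hu, hle⟩
        exact absurd hle (not_le.mpr (hne u hu))

theorem spikeCount_bound (Δ ξ : ℝ) (f : ℝ → ℝ) (hΔ : 0 < Δ) (hξ : ξ ∈ Set.Ico 0 Δ)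
    (hf0 : ∀ s, 0 ≤ f s) (hfi : ∀ T : ℝ, 0 ≤ T → IntervalIntegrable f volume 0 T)
    (t : ℝ) (ht : 0 ≤ t) :
    |(∫ s in (0 : ℝ)..t, f s) - Δ * (spikeCount Δ ξ f t : ℝ)| ≤ Δ := by
  have hF : 0 ≤ ∫ s in (0 : ℝ)..t, f s :=
    intervalIntegral.integral_nonneg ht (fun s _ => hf0 s)
  have hset : {j : ℕ | 1 ≤ j ∧ spikeTime Δ ξ f j ≤ (t : EReal)}
      = ((Finset.Icc 1 ⌊(ξ + ∫ s in (0 : ℝ)..t, f s) / Δ⌋₊ : Finset ℕ) : Set ℕ) := by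
    ext j
    simp only [Set.mem_ofPred_eq, Finset.coe_Icc, Set.mem_Icc]
    refine and_congr_right fun hj => ?_
    rw [Nat.le_floor_iff (div_nonneg (add_nonneg hξ.1 hF) hΔ.le), le_div_iff₀ hΔ]
    rcases spikeTime_char Δ ξ f hΔ hξ hf0 hfi j with ⟨htop, hlt⟩ | ⟨τ, hτ0, hτ, -, h⟩
    · rw [htop]
      have := hlt t ht
      simp [this]
    · obtain ⟨h1, h2⟩ := h (by omega)
      rw [hτ, EReal.coe_le_coe_iff]
      constructor
      · intro hle
        have h3 : 0 ≤ ∫ s in τ..t, f s := intervalIntegral.integral_nonneg hle (fun s _ => hf0 s)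
        rw [← intervalIntegral.integral_interval_sub_left (hfi t ht) (hfi τ hτ0)] at h3
        linarith
      · intro hle
        by_contra hcon
        exact absurd hle (not_le.mpr (h2 t ht (not_le.mp hcon)))
  have hcount : spikeCount Δ ξ f t = ⌊(ξ + ∫ s in (0 : ℝ)..t, f s) / Δ⌋₊ := by
    rw [spikeCount, hset, Set.ncard_coe_finset]
    simp
  have h1 := Nat.floor_le (div_nonneg (add_nonneg hξ.1 hF) hΔ.le)
  have h2 := Nat.lt_floor_add_one ((ξ + ∫ s in (0 : ℝ)..t, f s) / Δ)
  rw [← hcount] at h1 h2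
  rw [le_div_iff₀ hΔ] at h1
  rw [div_lt_iff₀ hΔ] at h2
  have h3 := hξ.1
  have h4 := hξ.2
  rw [abs_le]
  constructor <;> linarith

/-- Theorem 4, spiking approximation of continuous piecewise-affine functions:
the cumulative spiking output `Σ_{i=0}^{N+2} 𝒢 i · α i · N_i(t)` of the `(N+3)`-neuron
integrate-and-fire network approximates `∫₀ᵗ g(y(s)) ds` to within `Σ_{i=0}^{N+2} α i`, where
`g = pwa N b K c`, `α i = |K̄ i| Δ i` (`i ≤ N`), `α_{N+1} = Δ_{N+1}`, `α_{N+2} = Δ_{N+2}`, the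
signs `𝒢 i` follow the signs of `K̄ i`, and the neuron inputs are `max(0, −(y − b₁))`,
`max(0, y − b i)` (`1 ≤ i ≤ N`), `max(0, c)` and `max(0, −c)`. -/
theorem spiking_approximation_of_pwa
    (N : ℕ) (hN : 1 ≤ N) (b K : ℕ → ℝ) (c : ℝ)
    (hb : ∀ i : ℕ, 1 ≤ i → i < N → b i ≤ b (i + 1))
    (Kbar : ℕ → ℝ)
    (hKbar : ∀ i : ℕ, Kbar i = if i ≤ 1 then K i else K i - K (i - 1))
    (Δ α 𝒢 ξ : ℕ → ℝ)
    (hΔ : ∀ i : ℕ, i ≤ N → 0 < Δ i)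
    (hα : ∀ i : ℕ, i ≤ N → α i = |Kbar i| * Δ i)
    (h𝒢mem : ∀ i : ℕ, i ≤ N → 𝒢 i = -1 ∨ 𝒢 i = 1)
    (h𝒢0 : (0 < Kbar 0 → 𝒢 0 = -1) ∧ (Kbar 0 < 0 → 𝒢 0 = 1))
    (h𝒢i : ∀ i : ℕ, 1 ≤ i → i ≤ N →
      (0 < Kbar i → 𝒢 i = 1) ∧ (Kbar i < 0 → 𝒢 i = -1))
    (hΔN1 : 0 < Δ (N + 1)) (hαN1 : α (N + 1) = Δ (N + 1))
    (hΔN2 : 0 < Δ (N + 2)) (hαN2 : α (N + 2) = Δ (N + 2))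
    (h𝒢N1 : 𝒢 (N + 1) = 1) (h𝒢N2 : 𝒢 (N + 2) = -1)
    (hξ : ∀ i : ℕ, i ≤ N + 2 → ξ i ∈ Set.Ico 0 (Δ i))
    (y : ℝ → ℝ) (hy_meas : Measurable y)
    (hy_bdd : ∀ T : ℝ, 0 < T → ∃ M : ℝ, ∀ᵐ s ∂volume, s ∈ Set.Icc (0 : ℝ) T → |y s| ≤ M)
    (f : ℕ → ℝ → ℝ)
    (hf0 : f 0 = fun s => max 0 (-(y s - b 1)))
    (hfi : ∀ i : ℕ, 1 ≤ i → i ≤ N → f i = fun s => max 0 (y s - b i))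
    (hfN1 : f (N + 1) = fun _ => max 0 c)
    (hfN2 : f (N + 2) = fun _ => max 0 (-c)) :
    ∀ t : ℝ, 0 ≤ t →
      |(∫ s in (0 : ℝ)..t, pwa N b K c (y s)) -
          ∑ i ∈ Finset.range (N + 3),
            𝒢 i * (α i * (spikeCount (Δ i) (ξ i) (f i) t : ℝ))| ≤
        ∑ i ∈ Finset.range (N + 3), α i := by
  intro t ht
  have hyint : ∀ T : ℝ, 0 ≤ T → IntervalIntegrable y volume 0 T := by
    intro T hT
    rcases hT.eq_or_lt with rfl | hT'
    · exact IntervalIntegrable.refl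
    obtain ⟨M, hM⟩ := hy_bdd T hT'
    rw [intervalIntegrable_iff_integrableOn_Icc_of_le hT]
    refine Measure.integrableOn_of_bounded (M := M) (by simp)
      hy_meas.aestronglyMeasurable ?_
    rw [ae_restrict_iff' measurableSet_Icc]
    filter_upwards [hM] with s hs hs'
    simpa using hs hs'
  have hmax : ∀ (h : ℝ → ℝ) (T : ℝ), IntervalIntegrable h volume 0 T →
      IntervalIntegrable (fun s => max 0 (h s)) volume 0 T := by
    intro h T hh
    constructor
    · simpa [max_comm, IntegrableOn] using hh.1.pos_part
    · simpa [max_comm, IntegrableOn] using hh.2.pos_part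
  have hcase : ∀ i : ℕ, i < N + 3 →
      i = 0 ∨ (1 ≤ i ∧ i ≤ N) ∨ i = N + 1 ∨ i = N + 2 := by
    intro i hi; omega
  have hfint : ∀ i : ℕ, i < N + 3 → ∀ T : ℝ, 0 ≤ T → IntervalIntegrable (f i) volume 0 T := by
    intro i hi T hT
    rcases hcase i hi with rfl | ⟨h1, h2⟩ | rfl | rfl
    · rw [hf0]
      exact hmax _ _ ((hyint T hT).sub intervalIntegrable_const).neg
    · rw [hfi i h1 h2]
      exact hmax _ _ ((hyint T hT).sub intervalIntegrable_const)
    · rw [hfN1]; exact intervalIntegrable_const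
    · rw [hfN2]; exact intervalIntegrable_const
  have hfnn : ∀ i : ℕ, i < N + 3 → ∀ s, 0 ≤ f i s := by
    intro i hi s
    rcases hcase i hi with rfl | ⟨h1, h2⟩ | rfl | rfl
    · rw [hf0]; exact le_max_left _ _
    · rw [hfi i h1 h2]; exact le_max_left _ _
    · rw [hfN1]; exact le_max_left _ _
    · rw [hfN2]; exact le_max_left _ _
  have hΔpos : ∀ i : ℕ, i < N + 3 → 0 < Δ i := by
    intro i hi
    rcases hcase i hi with rfl | ⟨h1, h2⟩ | rfl | rfl
    · exact hΔ 0 (by omega)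
    · exact hΔ i h2
    · exact hΔN1
    · exact hΔN2
  obtain ⟨w, hw⟩ : ∃ w : ℕ → ℝ, ∀ i, w i = if i = 0 then -Kbar 0 else if i ≤ N then Kbar i
    else if i = N + 1 then 1 else -1 := ⟨_, fun _ => rfl⟩
  have hw0 : w 0 = -Kbar 0 := by simp [hw]
  have hwi : ∀ i, 1 ≤ i → i ≤ N → w i = Kbar i := by
    intro i h1 h2
    have : i ≠ 0 := by omega
    simp [hw, this, h2]
  have hwN1 : w (N + 1) = 1 := by simp [hw]
  have hwN2 : w (N + 2) = -1 := by simp [hw]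
  have hwα : ∀ i, i < N + 3 → 𝒢 i * α i = w i * Δ i ∧ α i = |w i| * Δ i := by
    intro i hi
    rcases hcase i hi with rfl | ⟨h1, h2⟩ | rfl | rfl
    · rw [hw0, hα 0 (by omega), abs_neg]
      refine ⟨?_, rfl⟩
      rcases lt_trichotomy (Kbar 0) 0 with h | h | h
      · rw [h𝒢0.2 h, abs_of_neg h]; ring
      · simp [h]
      · rw [h𝒢0.1 h, abs_of_pos h]; ring
    · rw [hwi i h1 h2, hα i h2]
      refine ⟨?_, rfl⟩
      rcases lt_trichotomy (Kbar i) 0 with h | h | h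
      · rw [(h𝒢i i h1 h2).2 h, abs_of_neg h]; ring
      · simp [h]
      · rw [(h𝒢i i h1 h2).1 h, abs_of_pos h]; ring
    · rw [hwN1, hαN1, h𝒢N1]; simp
    · rw [hwN2, hαN2, h𝒢N2]; simp
  have hpwa : ∀ s, pwa N b K c (y s) = ∑ i ∈ Finset.range (N + 3), w i * f i s := by
    intro s
    rw [Finset.sum_range_succ, Finset.sum_range_succ, hwN1, hwN2, hfN1, hfN2,
      ← Finset.sum_range_add_sum_Ico _ (show 2 ≤ N + 1 by omega), Finset.sum_range_succ,
      Finset.sum_range_one, hw0, hwi 1 le_rfl hN, hf0, hfi 1 le_rfl hN, hKbar 0, hKbar 1]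
    have h1 : ∑ i ∈ Finset.Ico 2 (N + 1), w i * f i s
        = ∑ i ∈ Finset.Icc 2 N, (K i - K (i - 1)) * max 0 (y s - b i) := by
      refine Finset.sum_congr (by ext i; simp) ?_
      intro i hi
      rw [Finset.mem_Icc] at hi
      have h2 : ¬ i ≤ 1 := by omega
      rw [hwi i (by omega) hi.2, hfi i (by omega) hi.2, hKbar i, if_neg h2]
    have h3 : c = max 0 c - max 0 (-c) := by
      rcases le_total 0 c with h | h
      · rw [max_eq_right h, max_eq_left (by linarith)]; ring
      · rw [max_eq_left h, max_eq_right (by linarith)]; ring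
    rw [h1, pwa]
    simp only [zero_le_one, le_refl, if_true]
    linarith
  have hint : (∫ s in (0 : ℝ)..t, pwa N b K c (y s))
      = ∑ i ∈ Finset.range (N + 3), w i * ∫ s in (0 : ℝ)..t, f i s := by
    simp_rw [hpwa]
    rw [intervalIntegral.integral_finsetSum]
    · simp_rw [intervalIntegral.integral_const_mul]
    · intro i hi
      exact (hfint i (Finset.mem_range.mp hi) t ht).const_mul _
  rw [hint, ← Finset.sum_sub_distrib]
  refine (Finset.abs_sum_le_sum_abs _ _).trans (Finset.sum_le_sum fun i hi => ?_)
  have hi' := Finset.mem_range.mp hi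
  obtain ⟨h1, h2⟩ := hwα i hi'
  have hb := spikeCount_bound (Δ i) (ξ i) (f i) (hΔpos i hi') (hξ i (by omega)) (hfnn i hi')
    (hfint i hi') t ht
  have h3 : w i * (∫ s in (0 : ℝ)..t, f i s)
      - 𝒢 i * (α i * (spikeCount (Δ i) (ξ i) (f i) t : ℝ))
      = w i * ((∫ s in (0 : ℝ)..t, f i s) - Δ i * (spikeCount (Δ i) (ξ i) (f i) t : ℝ)) := by
    rw [← mul_assoc, h1]; ring
  rw [h3, abs_mul, h2]
  exact mul_le_mul_of_nonneg_left hb (abs_nonneg _)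
end

section
/- (MIMO emulation error ⋆-norm bound) Let y : [0,∞) → ℝ^{n_y} be measurable and locally essentially bounded with components y_j, and let K ∈ ℝ^{n_u×n_y} have all entries K_{ij} ≠ 0. Define the cumulative emulation error E : [0,∞) → ℝ^{n_u} componentwise by E_i(t) = ∫₀ᵗ ( Σ_{j=1}^{n_y} K_{ij} y_j(s) ) ds − U_i(t). Then sup_{t ≥ 0} |E(t)| ≤ sqrt( Σ_{i=1}^{n_u} ( Σ_{j=1}^{n_y} ( α_{1,i,j} + α_{2,i,j} ) )² ), where |·| is the Euclidean norm on ℝ^{n_u}. -/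
open MeasureTheory

lemma aux_spike_iff (Δ ξ₀ : ℝ) (f : ℝ → ℝ) (hξ : ξ₀ ∈ Set.Ico 0 Δ)
    (hf : ∀ s, 0 ≤ f s) (hi : ∀ a b, 0 ≤ a → 0 ≤ b → IntervalIntegrable f volume a b) (j : ℕ) :
    ((0 : ℝ) : EReal) ≤ spikeTime Δ ξ₀ f j ∧
    ∀ t : ℝ, 0 ≤ t → (spikeTime Δ ξ₀ f j ≤ (t : EReal) ↔
      (j : ℝ) * Δ ≤ ξ₀ + ∫ s in (0 : ℝ)..t, f s) := by
  obtain ⟨hξ0, hξ1⟩ := hξ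
  have hΔ : 0 < Δ := lt_of_le_of_lt hξ0 hξ1
  set F : ℝ → ℝ := fun t => ξ₀ + ∫ s in (0 : ℝ)..t, f s with hF
  have hF0 : F 0 = ξ₀ := by simp [hF]
  have hdiff : ∀ a b, 0 ≤ a → 0 ≤ b → F b - F a = ∫ s in a..b, f s := by
    intro a b ha hb
    have := intervalIntegral.integral_add_adjacent_intervals (hi 0 a le_rfl ha) (hi a b ha hb)
    simp only [hF]; linarith
  have hmono : ∀ a b, 0 ≤ a → a ≤ b → F a ≤ F b := by
    intro a b ha hab
    have h1 := hdiff a b ha (ha.trans hab)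
    have h2 : 0 ≤ ∫ s in a..b, f s := intervalIntegral.integral_nonneg hab (fun s _ => hf s)
    linarith
  have hcont : ∀ a b, 0 ≤ a → a ≤ b → ContinuousOn F (Set.Icc a b) := by
    intro a b ha hab
    have h1 : ContinuousOn (fun t => ∫ s in (0 : ℝ)..t, f s) (Set.uIcc 0 b) := by
      apply intervalIntegral.continuousOn_primitive_interval'
        (hi 0 b le_rfl (ha.trans hab)) Set.left_mem_uIcc
    rw [Set.uIcc_of_le (ha.trans hab)] at h1
    exact (continuousOn_const.add h1).mono (Set.Icc_subset_Icc_left ha)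
  change _ ∧ ∀ t : ℝ, 0 ≤ t → (spikeTime Δ ξ₀ f j ≤ (t : EReal) ↔ (j : ℝ) * Δ ≤ F t)
  induction j with
  | zero =>
    refine ⟨by simp [spikeTime], fun t ht => ?_⟩
    have h1 := hmono 0 t le_rfl ht
    have h2 : 0 ≤ F t := by linarith
    simp [spikeTime, h2, ht]
  | succ j ih =>
    obtain ⟨ih0, ih⟩ := ih
    have hle : spikeTime Δ ξ₀ f j ≤ spikeTime Δ ξ₀ f (j+1) := by
      rw [spikeTime]
      refine le_sInf ?_
      rintro x ⟨u, rfl, hu, -⟩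
      exact hu.le
    refine ⟨ih0.trans hle, fun t ht => ?_⟩
    rcases eq_or_ne (spikeTime Δ ξ₀ f j) ⊤ with htop | htop
    · have h1 : spikeTime Δ ξ₀ f (j+1) = ⊤ := by
        rw [htop] at hle; exact top_le_iff.mp hle
      have h2 := ih t ht
      rw [htop] at h2
      rw [h1]
      simp only [top_le_iff, EReal.coe_ne_top, false_iff, not_le] at h2 ⊢
      push_cast
      linarith
    · obtain ⟨s, hs⟩ : ∃ s : ℝ, spikeTime Δ ξ₀ f j = (s : EReal) := by
        refine ⟨(spikeTime Δ ξ₀ f j).toReal, (EReal.coe_toReal htop ?_).symm⟩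
        intro hb
        rw [hb] at ih0
        simp at ih0
      rw [hs] at ih0 ih
      have hs0 : 0 ≤ s := EReal.coe_le_coe_iff.mp ih0
      have hFs : F s = (if j = 0 then ξ₀ else 0) + j * Δ := by
        rcases Nat.eq_zero_or_pos j with h0 | hpos
        · subst h0
          have : s = 0 := by
            rw [spikeTime] at hs
            exact (EReal.coe_eq_coe_iff.mp hs).symm
          subst this
          simp [hF0]
        · have hj1 : (1 : ℝ) ≤ j := by exact_mod_cast hpos
          have h1 : (j : ℝ) * Δ ≤ F s := (ih s hs0).mp le_rfl
          have h2 : F 0 ≤ j * Δ := by rw [hF0]; nlinarith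
          obtain ⟨c, hc, hc2⟩ := intermediate_value_Icc hs0 (hcont 0 s le_rfl hs0) ⟨h2, h1⟩
          have h3 := EReal.coe_le_coe_iff.mp ((ih c hc.1).mpr hc2.ge)
          have : c = s := le_antisymm hc.2 h3
          rw [← this, hc2]
          simp [hpos.ne']
      have hFs' : F s < (j + 1) * Δ := by
        rw [hFs]; split_ifs <;> linarith
      have hset : spikeTime Δ ξ₀ f (j+1) = sInf {x : EReal | ∃ u : ℝ, x = (u : EReal) ∧
          s < u ∧ ((j : ℝ) + 1) * Δ ≤ F u} := by
        rw [spikeTime]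
        congr 1
        ext x
        refine exists_congr fun u => and_congr_right fun _ => ?_
        rw [hs, EReal.coe_lt_coe_iff, EReal.toReal_coe]
        refine and_congr_right fun hu => ?_
        rw [← hdiff s u hs0 (hs0.trans hu.le), hFs]
        constructor <;> intro h <;> linarith
      rw [hset]
      push_cast
      constructor
      · intro h
        by_contra hlt
        push Not at hlt
        obtain ⟨t', ht', hFt'⟩ : ∃ t', t < t' ∧ F t' < (j + 1) * Δ := by
          by_cases hc : F (t+1) < (j + 1) * Δ
          · exact ⟨t+1, by linarith, hc⟩
          · push Not at hc
            have hm : (F t + (j+1) * Δ) / 2 ∈ Set.Icc (F t) (F (t+1)) :=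
              ⟨by linarith, by linarith⟩
            obtain ⟨c, hc1, hc2⟩ := intermediate_value_Icc (by linarith)
              (hcont t (t+1) ht (by linarith)) hm
            refine ⟨c, lt_of_le_of_ne hc1.1 ?_, by rw [hc2]; linarith⟩
            rintro rfl
            linarith
        have : ((t' : ℝ) : EReal) ≤ (t : EReal) := by
          refine le_trans (le_sInf ?_) h
          rintro x ⟨u, rfl, hu, hFu⟩
          rw [EReal.coe_le_coe_iff]
          by_contra hh
          push Not at hh
          have := hmono u t' (hs0.trans hu.le) hh.le
          linarith
        rw [EReal.coe_le_coe_iff] at this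
        linarith
      · intro h
        refine sInf_le ⟨t, rfl, ?_, h⟩
        by_contra hh
        push Not at hh
        have := hmono t s ht hh
        linarith

lemma aux_count (Δ ξ₀ : ℝ) (f : ℝ → ℝ) (hξ : ξ₀ ∈ Set.Ico 0 Δ)
    (hf : ∀ s, 0 ≤ f s) (hi : ∀ a b, 0 ≤ a → 0 ≤ b → IntervalIntegrable f volume a b)
    (t : ℝ) (ht : 0 ≤ t) :
    |(∫ s in (0 : ℝ)..t, f s) - Δ * (spikeCount Δ ξ₀ f t : ℝ)| ≤ Δ := by
  have hΔ : 0 < Δ := lt_of_le_of_lt hξ.1 hξ.2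
  have hI : 0 ≤ ∫ s in (0 : ℝ)..t, f s := intervalIntegral.integral_nonneg ht (fun s _ => hf s)
  set I := ∫ s in (0 : ℝ)..t, f s with hIdef
  have hN : spikeCount Δ ξ₀ f t = ⌊(ξ₀ + I) / Δ⌋₊ := by
    have : {j : ℕ | 1 ≤ j ∧ spikeTime Δ ξ₀ f j ≤ (t : EReal)}
        = ((Finset.Icc 1 ⌊(ξ₀ + I) / Δ⌋₊ : Finset ℕ) : Set ℕ) := by
      ext j
      simp only [Set.mem_ofPred_eq, Finset.coe_Icc, Set.mem_Icc]
      refine and_congr_right fun _ => ?_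
      rw [(aux_spike_iff Δ ξ₀ f hξ hf hi j).2 t ht,
        Nat.le_floor_iff (div_nonneg (add_nonneg hξ.1 hI) hΔ.le), le_div_iff₀ hΔ]
    rw [spikeCount, this, Set.ncard_coe_finset]
    simp
  rw [hN]
  have h1 := Nat.floor_le (div_nonneg (add_nonneg hξ.1 hI) hΔ.le)
  have h2 := Nat.lt_floor_add_one ((ξ₀ + I) / Δ)
  rw [le_div_iff₀ hΔ] at h1
  rw [div_lt_iff₀ hΔ] at h2
  have := hξ.1
  have := hξ.2
  rw [abs_le]
  constructor <;> linarith

/-- MIMO emulation error ⋆-norm bound: the cumulative emulation error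
`E_i(t) = ∫₀ᵗ Σ_j K i j y_j(s) ds − U_i(t)` satisfies, in the Euclidean norm on `ℝ^{n_u}`,
`sup_{t ≥ 0} |E(t)| ≤ sqrt( Σ_i ( Σ_j (α₁ᵢⱼ + α₂ᵢⱼ) )² )`. -/
theorem mimo_emulation_error_star_norm_bound
    (nu ny : ℕ) (K : Fin nu → Fin ny → ℝ) (hK : ∀ i j, K i j ≠ 0)
    (α₁ α₂ Δ₁ Δ₂ ξ₁ ξ₂ : Fin nu → Fin ny → ℝ)
    (hα₁ : ∀ i j, 0 < α₁ i j) (hα₂ : ∀ i j, 0 < α₂ i j)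
    (hΔ₁ : ∀ i j, 0 < Δ₁ i j) (hΔ₂ : ∀ i j, 0 < Δ₂ i j)
    (hK₁ : ∀ i j, |K i j| = α₁ i j / Δ₁ i j)
    (hK₂ : ∀ i j, |K i j| = α₂ i j / Δ₂ i j)
    (hξ₁ : ∀ i j, ξ₁ i j ∈ Set.Ico 0 (Δ₁ i j))
    (hξ₂ : ∀ i j, ξ₂ i j ∈ Set.Ico 0 (Δ₂ i j))
    (y : Fin ny → ℝ → ℝ) (hy_meas : ∀ j, Measurable (y j))
    (hy_bdd : ∀ j, ∀ T : ℝ, 0 < T →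
      ∃ M : ℝ, ∀ᵐ s ∂volume, s ∈ Set.Icc (0 : ℝ) T → |y j s| ≤ M)
    (E : Fin nu → ℝ → ℝ)
    (hE : ∀ i t, E i t =
      (∫ s in (0 : ℝ)..t, ∑ j, K i j * y j s) -
        ∑ j, Real.sign (K i j) *
          (α₁ i j * (spikeCount (Δ₁ i j) (ξ₁ i j) (fun s => max 0 (y j s)) t : ℝ) -
            α₂ i j * (spikeCount (Δ₂ i j) (ξ₂ i j) (fun s => max 0 (-(y j s))) t : ℝ))) :
    ∀ t : ℝ, 0 ≤ t →
      Real.sqrt (∑ i, (E i t) ^ 2) ≤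
        Real.sqrt (∑ i, (∑ j, (α₁ i j + α₂ i j)) ^ 2) := by
  intro t ht
  have hyi : ∀ j a b, 0 ≤ a → 0 ≤ b → IntervalIntegrable (y j) volume a b := by
    intro j
    have h0 : ∀ b, 0 ≤ b → IntervalIntegrable (y j) volume 0 b := by
      intro b hb
      obtain ⟨M, hM⟩ := hy_bdd j (b+1) (by linarith)
      rw [intervalIntegrable_iff_integrableOn_Icc_of_le hb]
      refine Measure.integrableOn_of_bounded (M := M) (by simp)
        (hy_meas j).aestronglyMeasurable ?_
      rw [ae_restrict_iff' measurableSet_Icc]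
      filter_upwards [hM] with s hs hs2
      exact hs ⟨hs2.1, by linarith [hs2.2]⟩
    intro a b ha hb
    exact (h0 a ha).symm.trans (h0 b hb)
  have hpi : ∀ j a b, 0 ≤ a → 0 ≤ b →
      IntervalIntegrable (fun s => max 0 (y j s)) volume a b := by
    intro j a b ha hb
    exact ⟨by simpa [max_comm, IntegrableOn] using (hyi j a b ha hb).1.pos_part,
      by simpa [max_comm, IntegrableOn] using (hyi j a b ha hb).2.pos_part⟩
  have hni : ∀ j a b, 0 ≤ a → 0 ≤ b →
      IntervalIntegrable (fun s => max 0 (-(y j s))) volume a b := by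
    intro j a b ha hb
    exact ⟨by simpa [max_comm, IntegrableOn] using (hyi j a b ha hb).1.neg_part,
      by simpa [max_comm, IntegrableOn] using (hyi j a b ha hb).2.neg_part⟩
  apply Real.sqrt_le_sqrt
  refine Finset.sum_le_sum fun i _ => ?_
  apply sq_le_sq'
  all_goals
    have key : |E i t| ≤ ∑ j, (α₁ i j + α₂ i j) := by
      rw [hE, intervalIntegral.integral_finsetSum
        (fun j _ => (hyi j 0 t le_rfl ht).const_mul _), ← Finset.sum_sub_distrib]
      refine (Finset.abs_sum_le_sum_abs _ _).trans (Finset.sum_le_sum fun j _ => ?_)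
      have h1 := aux_count _ _ _ (hξ₁ i j) (fun s => le_max_left 0 (y j s)) (hpi j) t ht
      have h2 := aux_count _ _ _ (hξ₂ i j) (fun s => le_max_left 0 (-(y j s))) (hni j) t ht
      have hI : ∫ s in (0 : ℝ)..t, y j s = (∫ s in (0 : ℝ)..t, max 0 (y j s))
          - ∫ s in (0 : ℝ)..t, max 0 (-(y j s)) := by
        rw [← intervalIntegral.integral_sub (hpi j 0 t le_rfl ht) (hni j 0 t le_rfl ht)]
        congr 1
        ext s
        rcases le_total 0 (y j s) with h | h
        · rw [max_eq_right h, max_eq_left (by linarith)]; ring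
        · rw [max_eq_left h, max_eq_right (by linarith)]; ring
      rw [intervalIntegral.integral_const_mul, hI]
      generalize (∫ s in (0 : ℝ)..t, max 0 (y j s)) = P at *
      generalize (∫ s in (0 : ℝ)..t, max 0 (-(y j s))) = Q at *
      generalize (spikeCount (Δ₁ i j) (ξ₁ i j) (fun s => max 0 (y j s)) t : ℝ) = N at *
      generalize (spikeCount (Δ₂ i j) (ξ₂ i j) (fun s => max 0 (-(y j s))) t : ℝ) = L at *
      have ha1 : α₁ i j = |K i j| * Δ₁ i j := by rw [hK₁]; field_simp [(hΔ₁ i j).ne']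
      have ha2 : α₂ i j = |K i j| * Δ₂ i j := by rw [hK₂]; field_simp [(hΔ₂ i j).ne']
      have hsg : Real.sign (K i j) * |K i j| = K i j := by
        rcases lt_or_gt_of_ne (hK i j) with h | h
        · rw [Real.sign_of_neg h, abs_of_neg h]; ring
        · rw [Real.sign_of_pos h, abs_of_pos h]; ring
      have heq : K i j * (P - Q) - Real.sign (K i j) * (α₁ i j * N - α₂ i j * L)
          = K i j * ((P - Δ₁ i j * N) - (Q - Δ₂ i j * L)) := by
        rw [ha1, ha2]
        linear_combination (-(Δ₁ i j * N) + Δ₂ i j * L) * hsg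
      rw [heq, abs_mul, ha1, ha2, ← mul_add]
      exact mul_le_mul_of_nonneg_left ((abs_sub _ _).trans (add_le_add h1 h2)) (abs_nonneg _)
    have := abs_le.mp key
    first
      | exact this.1
      | exact this.2
end
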